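/- Let (V,c) be a finite metric space with root r ∈ V and let α ≥ 1. If there exists a probability distribution D over spanning trees of V such that for every X ⊆ V, E_{T←D}[c(T[X])] ≤ α·opt_ST(X), then there exists a probability distribution D' over permutations σ of V such that for every X ⊆ V, E_{σ←D'}[c(σ_X)] ≤ 2α·opt_TSP(X). That is, an α-approximate universal Steiner tree algorithm (returning spanning trees) implies a 2α-approximate universal TSP algorithm. -/

import Mathlib

open scoped Classical

noncomputable section

/-- A finitely supported probability distribution on a type `A`. -/
structure FinDist (A : Type*) where
  w : A →₀ ℝ
  nonneg : ∀ a, 0 ≤ w a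
  total : ∑ a ∈ w.support, w a = 1

namespace FinDist

variable {A : Type*}

/-- The (finite) support of a finitely supported distribution. -/
def support (D : FinDist A) : Finset A := D.w.support

/-- The probability of an event under a finitely supported distribution. -/
def pr (D : FinDist A) (p : A → Prop) : ℝ :=
  ∑ a ∈ D.support.filter p, D.w a

/-- The expectation of a real-valued function under a finitely supported distribution. -/
def exp (D : FinDist A) (f : A → ℝ) : ℝ :=
  ∑ a ∈ D.support, D.w a * f a

end FinDist

/-- `c` is a metric on `V`. -/
structure IsMetric {V : Type*} (c : V → V → ℝ) : Prop where
  refl : ∀ x, c x x = 0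
  pos : ∀ x y, x ≠ y → 0 < c x y
  symm : ∀ x y, c x y = c y x
  triangle : ∀ x y z, c x z ≤ c x y + c y z

/-- The cost of an unordered pair of vertices (agrees with `c` when `c` is symmetric). -/
def sym2Cost {V : Type*} (c : V → V → ℝ) : Sym2 V → ℝ :=
  Sym2.lift ⟨fun x y => (c x y + c y x) / 2, fun x y => by dsimp; ring⟩

/-- A path (sequence of distinct vertices) from `v` to `r`. -/
def RootPath (V : Type*) (v r : V) : Type _ :=
  {l : List V // l.Nodup ∧ l.head? = some v ∧ l.getLast? = some r}

/-- A collection of vertex-to-root paths, one for each vertex. -/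
def PathSystem (V : Type*) (r : V) : Type _ := ∀ v : V, RootPath V v r

/-- The set of (unordered) edges of a list of vertices: pairs of consecutive entries. -/
def listEdges {V : Type*} [DecidableEq V] (l : List V) : Finset (Sym2 V) :=
  ((l.zip l.tail).map (fun p => s(p.1, p.2))).toFinset

/-- `c(P[X])`: the total cost of the union of the edges of the paths `p_v`, `v ∈ X`. -/
def pathSystemCost {V : Type*} [DecidableEq V] (c : V → V → ℝ) {r : V}
    (P : PathSystem V r) (X : Finset V) : ℝ :=
  ∑ e ∈ X.biUnion (fun v => listEdges (P v).1), sym2Cost c e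

/-- The set of costs of Steiner trees for `X ∪ {r}`: trees `T` on vertex sets `W`
with `X ∪ {r} ⊆ W ⊆ V`. -/
def steinerCosts {V : Type*} [Fintype V] [DecidableEq V] (c : V → V → ℝ) (r : V)
    (X : Finset V) : Set ℝ :=
  {y | ∃ (W : Finset V) (T : SimpleGraph V),
    insert r X ⊆ W ∧
    (∀ e ∈ T.edgeSet, ∀ v ∈ e, v ∈ W) ∧
    (SimpleGraph.induce (↑W) T).IsTree ∧
    y = ∑ e ∈ Finset.univ.filter (fun e : Sym2 V => e ∈ T.edgeSet), sym2Cost c e}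

/-- `opt_ST(X)`: the optimal Steiner tree cost for `X ∪ {r}`. -/
def optST {V : Type*} [Fintype V] [DecidableEq V] (c : V → V → ℝ) (r : V)
    (X : Finset V) : ℝ :=
  sInf (steinerCosts c r X)

/-- The cost of the closed tour that starts at `r`, visits the vertices of `l` in order,
and returns to `r`. -/
def tourCost {V : Type*} (c : V → V → ℝ) (r : V) (l : List V) : ℝ :=
  ((((r :: l) ++ [r]).zip (((r :: l) ++ [r]).tail)).map (fun p => c p.1 p.2)).sum

/-- `σ_X`: the ordering that the tour `σ` induces on the elements of `X`. -/
def permInduced {n : ℕ} (σ : Equiv.Perm (Fin n)) (X : Finset (Fin n)) : List (Fin n) :=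
  ((List.finRange n).map σ).filter (fun v => decide (v ∈ X))

/-- `opt_TSP(X)`: the minimum closed-tour cost through `X ∪ {r}`. -/
def optTSP {V : Type*} [DecidableEq V] (c : V → V → ℝ) (r : V) (X : Finset V) : ℝ :=
  sInf {y | ∃ l : List V, l.Nodup ∧ l.toFinset = X ∧ y = tourCost c r l}

/-- An `(n,d,β)`-expander: a `d`-regular graph on `n` vertices such that
`|xᵀAx| ≤ β·d·xᵀx` for every `x` orthogonal to the all-ones vector. -/
def IsExpander (n d : ℕ) (β : ℝ) (G : SimpleGraph (Fin n)) : Prop :=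
  (∀ v : Fin n, (Finset.univ.filter (fun w => G.Adj v w)).card = d) ∧
  ∀ x : Fin n → ℝ, (∑ v, x v = 0) →
    |∑ v, ∑ w, (if G.Adj v w then x v * x w else 0)| ≤ β * d * ∑ v, (x v) ^ 2

/-- `u : Fin (t+1) → Fin n` encodes a `t`-step walk in `G`. -/
def IsWalkFun {n : ℕ} (G : SimpleGraph (Fin n)) {t : ℕ} (u : Fin (t + 1) → Fin n) : Prop :=
  ∀ i : Fin t, G.Adj (u i.castSucc) (u i.succ)

/-- The probability that a `t`-step random walk on a `d`-regular graph `G`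
(uniform start, uniform steps; each walk has probability `1/(n·dᵗ)`) satisfies `p`. -/
def walkPr {n : ℕ} (G : SimpleGraph (Fin n)) (d t : ℕ)
    (p : (Fin (t + 1) → Fin n) → Prop) : ℝ :=
  ((Finset.univ.filter
      (fun u : Fin (t + 1) → Fin n => IsWalkFun G u ∧ p u)).card : ℝ) / (n * d ^ t)

/-- The probability that two independent `t`-step random walks on `G` satisfy `p`. -/
def walkPairPr {n : ℕ} (G : SimpleGraph (Fin n)) (d t : ℕ)
    (p : (Fin (t + 1) → Fin n) → (Fin (t + 1) → Fin n) → Prop) : ℝ :=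
  ((Finset.univ.filter
      (fun q : (Fin (t + 1) → Fin n) × (Fin (t + 1) → Fin n) =>
        IsWalkFun G q.1 ∧ IsWalkFun G q.2 ∧ p q.1 q.2)).card : ℝ) / (n * d ^ t) ^ 2

/-- The edge set of the path from `u` to `v` in `T` (the unique such path when `T`
is a tree); empty if `u` and `v` are not connected in `T`. -/
def treePathEdges {V : Type*} [DecidableEq V] (T : SimpleGraph V) (u v : V) :
    Finset (Sym2 V) :=
  if h : T.Reachable u v then (h.some.toPath : T.Path u v).1.edges.toFinset else ∅

/-- `c_T(u,v)`: the cost of the unique `u`–`v` path in the tree `T`. -/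
def treePathCost {V : Type*} [DecidableEq V] (c : V → V → ℝ) (T : SimpleGraph V)
    (u v : V) : ℝ :=
  ∑ e ∈ treePathEdges T u v, sym2Cost c e

/-- `c(T[X])`: the cost of the minimal subtree of the tree `T` containing `X ∪ {r}`. -/
def subtreeCost {V : Type*} [DecidableEq V] (c : V → V → ℝ) (T : SimpleGraph V)
    (r : V) (X : Finset V) : ℝ :=
  ∑ e ∈ (insert r X).biUnion (fun v => treePathEdges T v r), sym2Cost c e

end

/-- The cost of the walk that visits the entries of a list in order. -/
noncomputable def walkCost {V : Type*} (c : V → V → ℝ) (l : List V) : ℝ :=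
  ((l.zip l.tail).map (fun p => c p.1 p.2)).sum

section ListCost

variable {V : Type*} {c : V → V → ℝ}

theorem tourCost_eq_walkCost (r : V) (l : List V) :
    tourCost c r l = walkCost c (r :: (l ++ [r])) := rfl

@[simp]
theorem walkCost_singleton (a : V) : walkCost c [a] = 0 := by simp [walkCost]

@[simp]
theorem walkCost_cons_cons (a b : V) (l : List V) :
    walkCost c (a :: b :: l) = c a b + walkCost c (b :: l) := by
  simp [walkCost]

theorem walkCost_append_cons (A : List V) (p : V) (B : List V) :
    walkCost c (A ++ p :: B) = walkCost c (A ++ [p]) + walkCost c (p :: B) := by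
  induction A with
  | nil => simp
  | cons a A ih =>
    cases A with
    | nil => simp
    | cons b A =>
      simp only [List.cons_append, walkCost_cons_cons] at ih ⊢
      rw [ih, add_assoc]

theorem IsMetric.nonneg (hc : IsMetric c) (x y : V) : 0 ≤ c x y := by
  rcases eq_or_ne x y with rfl | h
  · exact (hc.refl x).ge
  · exact (hc.pos x y h).le

theorem IsMetric.sym2Cost_mk (hc : IsMetric c) (x y : V) : sym2Cost c s(x, y) = c x y := by
  simp [sym2Cost, hc.symm y x]

theorem IsMetric.sym2Cost_nonneg (hc : IsMetric c) (e : Sym2 V) : 0 ≤ sym2Cost c e := by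
  induction e with
  | h x y => exact hc.sym2Cost_mk x y ▸ hc.nonneg x y

theorem IsMetric.walkCost_cons_le (hc : IsMetric c) (a b : V) (l : List V) :
    walkCost c (a :: l) ≤ c a b + walkCost c (b :: l) := by
  cases l with
  | nil => simpa using hc.nonneg a b
  | cons x l =>
    simp only [walkCost_cons_cons]
    linarith [hc.triangle a b x]

theorem IsMetric.walkCost_le_of_sublist (hc : IsMetric c) (z : V) {l₁ l₂ : List V}
    (h : l₁.Sublist l₂) (a : V) :
    walkCost c (a :: (l₁ ++ [z])) ≤ walkCost c (a :: (l₂ ++ [z])) := by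
  induction h generalizing a with
  | slnil => exact le_rfl
  | cons b _ ih =>
    rw [List.cons_append, walkCost_cons_cons]
    exact (ih a).trans (hc.walkCost_cons_le a b _)
  | cons_cons b _ ih =>
    simp only [List.cons_append, walkCost_cons_cons]
    exact add_le_add_right (ih b) _

theorem IsMetric.tourCost_le_of_sublist (hc : IsMetric c) (r : V) {l₁ l₂ : List V}
    (h : l₁.Sublist l₂) : tourCost c r l₁ ≤ tourCost c r l₂ :=
  hc.walkCost_le_of_sublist r h r

/-- Visiting `v` immediately after `p` costs at most a detour from `p` to `v` and back. -/
theorem IsMetric.tourCost_insert_le (hc : IsMetric c) (r p v : V) (A B : List V) :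
    tourCost c r (A ++ p :: v :: B) ≤ tourCost c r (A ++ p :: B) + 2 * c p v := by
  have h₁ := walkCost_append_cons (c := c) (r :: A) p (v :: (B ++ [r]))
  have h₂ := walkCost_append_cons (c := c) (r :: A) p (B ++ [r])
  have h₃ := hc.walkCost_cons_le v p (B ++ [r])
  simp only [tourCost_eq_walkCost, List.cons_append, List.append_assoc, walkCost_cons_cons]
    at h₁ h₂ ⊢
  rw [h₁, h₂]
  linarith [hc.symm p v]

end ListCost

section SteinerVersusTour

variable {V : Type*} {c : V → V → ℝ}

/-- A list of vertices can be read as a walk of the complete graph, skipping repetitions. -/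
theorem IsMetric.exists_walk_of_list (hc : IsMetric c) (a : V) (l : List V) :
    ∃ (b : V) (p : (⊤ : SimpleGraph V).Walk a b),
      (∀ x, x ∈ p.support ↔ x ∈ a :: l) ∧
      (p.edges.map (sym2Cost c)).sum ≤ walkCost c (a :: l) := by
  induction l generalizing a with
  | nil => exact ⟨a, .nil, by simp, by simp⟩
  | cons x l ih =>
    obtain ⟨b, p, hp, hcost⟩ := ih x
    rcases eq_or_ne a x with rfl | hax
    · exact ⟨b, p, fun y => by simp [hp], by simpa [hc.refl] using hcost⟩
    · refine ⟨b, .cons (by simpa using hax) p, fun y => by simp [hp], ?_⟩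
      simpa [hc.sym2Cost_mk] using hcost

theorem IsMetric.sum_toFinset_sym2Cost_le [DecidableEq V] (hc : IsMetric c)
    (l : List (Sym2 V)) : ∑ e ∈ l.toFinset, sym2Cost c e ≤ (l.map (sym2Cost c)).sum := by
  induction l with
  | nil => simp
  | cons a l ih =>
    by_cases h : a ∈ l
    · rw [List.toFinset_cons, Finset.insert_eq_of_mem (by simpa using h)]
      simpa using ih.trans (le_add_of_nonneg_left (hc.sym2Cost_nonneg a))
    · rw [List.toFinset_cons, Finset.sum_insert (by simpa using h)]
      simpa using ih

variable [Fintype V] [DecidableEq V]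

theorem IsMetric.exists_steinerCosts_le_tourCost (hc : IsMetric c) (r : V) (l : List V) :
    ∃ y ∈ steinerCosts c r l.toFinset, y ≤ tourCost c r l := by
  obtain ⟨b, p, hsupp, hcost⟩ := hc.exists_walk_of_list r (l ++ [r])
  set W : Finset V := insert r l.toFinset with hW
  set G : SimpleGraph V := SimpleGraph.fromEdgeSet {e | e ∈ p.edges} with hG
  have hedge : ∀ e ∈ p.edges, e ∈ G.edgeSet := fun e he => by
    rw [hG, SimpleGraph.edgeSet_fromEdgeSet]
    exact ⟨he, SimpleGraph.not_isDiag_of_mem_edgeSet _ (p.edges_subset_edgeSet he)⟩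
  have hconn : (G.induce (↑W : Set V)).Connected := by
    have h := (p.transfer G hedge).connected_induce_support
    have hset : {v | v ∈ (p.transfer G hedge).support} = (↑W : Set V) := by
      ext x
      simp only [SimpleGraph.Walk.support_transfer, Set.mem_ofPred_eq, hsupp, hW, List.mem_cons,
        List.mem_append, Finset.coe_insert, Set.mem_insert_iff, List.coe_toFinset,
        List.not_mem_nil]
      tauto
    rwa [hset] at h
  obtain ⟨T, hTG, hT⟩ := hconn.exists_isTree_le
  obtain ⟨S, hSp, hSW, hS⟩ : ∃ S : SimpleGraph V, (∀ e ∈ S.edgeSet, e ∈ p.edges) ∧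
      (∀ e ∈ S.edgeSet, ∀ v ∈ e, v ∈ W) ∧ (S.induce (↑W : Set V)).IsTree := by
    refine ⟨T.map (Function.Embedding.subtype (· ∈ (↑W : Set V))), fun e he => ?_,
      fun e he v hv => ?_, ?_⟩
    · induction e with
      | h x y =>
        obtain ⟨u, v, huv, rfl, rfl⟩ := (SimpleGraph.map_adj _ _ _ _).1 he
        have := hTG huv
        simp only [SimpleGraph.comap_adj, hG, SimpleGraph.fromEdgeSet_adj] at this
        exact this.1
    · induction e with
      | h x y =>
        obtain ⟨u, w, -, rfl, rfl⟩ := (SimpleGraph.map_adj _ _ _ _).1 he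
        rcases Sym2.mem_iff.1 hv with rfl | rfl
        · exact u.2
        · exact w.2
    · have h := SimpleGraph.comap_map_eq (Function.Embedding.subtype (· ∈ (↑W : Set V))) T
      unfold SimpleGraph.induce
      rwa [h]
  refine ⟨_, ⟨W, S, subset_rfl, hSW, hS, rfl⟩, ?_⟩
  refine le_trans ?_ ((hc.sum_toFinset_sym2Cost_le p.edges).trans hcost)
  refine Finset.sum_le_sum_of_subset_of_nonneg (fun e he => ?_) fun e _ _ => hc.sym2Cost_nonneg e
  exact List.mem_toFinset.2 (hSp e (Finset.mem_filter.1 he).2)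

theorem IsMetric.optST_le_optTSP (hc : IsMetric c) (r : V) (X : Finset V) :
    optST c r X ≤ optTSP c r X := by
  refine le_csInf ⟨_, X.toList, X.nodup_toList, X.toList_toFinset, rfl⟩ ?_
  rintro _ ⟨l, -, rfl, rfl⟩
  obtain ⟨y, hy, hle⟩ := hc.exists_steinerCosts_le_tourCost r l
  refine (csInf_le ⟨0, ?_⟩ hy).trans hle
  rintro _ ⟨W, T, -, -, -, rfl⟩
  exact Finset.sum_nonneg fun e _ => hc.sym2Cost_nonneg e

end SteinerVersusTour

section DepthFirstOrder

variable {V : Type*} [DecidableEq V] {c : V → V → ℝ} {T : SimpleGraph V} {r : V}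

theorem treePathEdges_eq_of_isPath (hT : T.IsTree) {u v : V} (p : T.Walk u v) (hp : p.IsPath) :
    treePathEdges T u v = p.edges.toFinset := by
  have h : T.Reachable u v := ⟨p⟩
  rw [treePathEdges, dif_pos h, (hT.isAcyclic.subsingleton_path u v).elim h.some.toPath ⟨p, hp⟩]

/-- A list that enumerates a subtree of `T` containing `r`, such that shortcutting the list to
any of its subsets `X` gives a tour of cost at most twice the cost of `T[X]`. -/
def IsShortcutOrder (c : V → V → ℝ) (T : SimpleGraph V) (r : V) (L : List V) : Prop :=
  L.Nodup ∧ r ∈ L ∧ (∀ u ∈ L, ∀ e ∈ treePathEdges T u r, ∀ x ∈ e, x ∈ L) ∧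
    ∀ X : Finset V, X ⊆ L.toFinset →
      tourCost c r (L.filter (fun v => decide (v ∈ X))) ≤ 2 * subtreeCost c T r X

theorem IsMetric.subtreeCost_nonneg (hc : IsMetric c) (T : SimpleGraph V) (r : V)
    (X : Finset V) : 0 ≤ subtreeCost c T r X :=
  Finset.sum_nonneg fun e _ => hc.sym2Cost_nonneg e

theorem IsShortcutOrder.singleton_root (hc : IsMetric c) (hT : T.IsTree) :
    IsShortcutOrder c T r [r] := by
  refine ⟨by simp, by simp, ?_, fun X _ => ?_⟩
  · intro u hu e he
    obtain rfl : u = r := by simpa using hu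
    simp [treePathEdges_eq_of_isPath hT .nil .nil] at he
  · refine le_trans ?_ (mul_nonneg zero_le_two (hc.subtreeCost_nonneg T r X))
    refine (hc.tourCost_le_of_sublist r List.filter_sublist).trans ?_
    simp [tourCost_eq_walkCost, hc.refl]

/-- Inserting a new leaf `v` immediately after its neighbour `p`. -/
theorem IsShortcutOrder.insert_leaf (hc : IsMetric c) (hT : T.IsTree) {A B : List V} {p v : V}
    (hL : IsShortcutOrder c T r (A ++ p :: B)) (hpv : T.Adj p v) (hv : v ∉ A ++ p :: B) :
    IsShortcutOrder c T r (A ++ p :: v :: B) := by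
  obtain ⟨hnodup, hr, hclosed, hcost⟩ := hL
  have hpL : p ∈ A ++ p :: B := by simp
  have hmem : ∀ x, x ∈ A ++ p :: v :: B ↔ x = v ∨ x ∈ A ++ p :: B := fun x => by
    simp only [List.mem_append, List.mem_cons]
    tauto
  have hvr : v ≠ r := fun h => hv (h ▸ hr)
  have hvedge : ∀ u ∈ A ++ p :: B, s(v, p) ∉ treePathEdges T u r := fun u hu he =>
    hv (hclosed u hu _ he v (Sym2.mem_mk_left v p))
  have hpath : treePathEdges T v r = insert s(v, p) (treePathEdges T p r) := by
    obtain ⟨q, hq⟩ := hT.connected.exists_isPath p r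
    have hq' := treePathEdges_eq_of_isPath hT q hq
    have hvq : v ∉ q.support := fun h => by
      rcases SimpleGraph.Walk.mem_support_iff_exists_mem_edges.1 h with h | ⟨e, he, hve⟩
      · exact hvr h
      · exact hv (hclosed p hpL e (by simpa [hq'] using he) v hve)
    rw [treePathEdges_eq_of_isPath hT (.cons hpv.symm q) (hq.cons hvq), hq']
    simp
  refine ⟨?_, (hmem r).2 (.inr hr), fun u hu e he x hx => ?_, fun X hX => ?_⟩
  · have h : (A ++ p :: v :: B).Perm (v :: (A ++ p :: B)) := by
      simpa using List.perm_middle (a := v) (l₁ := A ++ [p]) (l₂ := B)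
    exact h.nodup_iff.2 (List.nodup_cons.2 ⟨hv, hnodup⟩)
  · rw [hmem] at hu ⊢
    rcases hu with rfl | hu
    · rw [hpath, Finset.mem_insert] at he
      rcases he with rfl | he
      · rcases Sym2.mem_iff.1 hx with rfl | rfl
        · exact .inl rfl
        · exact .inr hpL
      · exact .inr (hclosed p hpL e he x hx)
    · exact .inr (hclosed u hu e he x hx)
  · by_cases hvX : v ∈ X
    · set Y := insert p (X.erase v) with hY
      have hYL : Y ⊆ (A ++ p :: B).toFinset := by
        intro x hx
        rw [List.mem_toFinset]
        rcases Finset.mem_insert.1 hx with rfl | hx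
        · exact hpL
        · have := (hmem x).1 (List.mem_toFinset.1 (hX (Finset.mem_of_mem_erase hx)))
          exact this.resolve_left (Finset.ne_of_mem_erase hx)
      have hfilter : ∀ C : List V, v ∉ C →
          C.filter (fun x => decide (x ∈ insert p X)) = C.filter (fun x => decide (x ∈ Y)) := by
        refine fun C hC => List.filter_congr fun x hx => ?_
        have : x ≠ v := fun h => hC (h ▸ hx)
        simp [hY, this]
      have htour : tourCost c r ((A ++ p :: v :: B).filter (fun x => decide (x ∈ X))) ≤
          tourCost c r ((A ++ p :: B).filter (fun x => decide (x ∈ Y))) + 2 * c p v := by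
        have hsub : ((A ++ p :: v :: B).filter (fun x => decide (x ∈ X))).Sublist
            ((A ++ p :: v :: B).filter (fun x => decide (x ∈ insert p X))) :=
          List.monotone_filter_right _ fun x hx => by simp_all
        refine (hc.tourCost_le_of_sublist r hsub).trans ?_
        have hA : v ∉ A := fun h => hv (by simp [h])
        have hB : v ∉ B := fun h => hv (by simp [h])
        have hpY : p ∈ Y := Finset.mem_insert_self _ _
        rw [List.filter_append, List.filter_cons_of_pos (by simp),
          List.filter_cons_of_pos (by simp [hvX]), hfilter A hA, hfilter B hB,
          List.filter_append, List.filter_cons_of_pos (by simp [hpY])]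
        exact hc.tourCost_insert_le r p v _ _
      have htree : c p v + subtreeCost c T r Y ≤ subtreeCost c T r X := by
        have hnot : s(v, p) ∉ (insert r Y).biUnion (fun u => treePathEdges T u r) := by
          intro h
          obtain ⟨u, hu, he⟩ := Finset.mem_biUnion.1 h
          refine hvedge u ?_ he
          rcases Finset.mem_insert.1 hu with rfl | hu
          · exact hr
          · exact List.mem_toFinset.1 (hYL hu)
        rw [hc.symm p v, ← hc.sym2Cost_mk v p, subtreeCost, ← Finset.sum_insert hnot]
        refine Finset.sum_le_sum_of_subset_of_nonneg (fun e he => ?_)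
          fun e _ _ => hc.sym2Cost_nonneg e
        have hsubv : ∀ e ∈ treePathEdges T v r,
            e ∈ (insert r X).biUnion (fun u => treePathEdges T u r) := fun e he =>
          Finset.mem_biUnion.2 ⟨v, Finset.mem_insert_of_mem hvX, he⟩
        rcases Finset.mem_insert.1 he with rfl | he
        · exact hsubv _ (hpath ▸ Finset.mem_insert_self _ _)
        · obtain ⟨u, hu, heu⟩ := Finset.mem_biUnion.1 he
          simp only [hY, Finset.mem_insert, Finset.mem_erase] at hu
          rcases hu with rfl | rfl | ⟨-, hu⟩
          · exact Finset.mem_biUnion.2 ⟨u, Finset.mem_insert_self _ _, heu⟩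
          · exact hsubv _ (hpath ▸ Finset.mem_insert_of_mem heu)
          · exact Finset.mem_biUnion.2 ⟨u, Finset.mem_insert_of_mem hu, heu⟩
      linarith [hcost Y hYL]
    · have hXL : X ⊆ (A ++ p :: B).toFinset := fun x hx => by
        have := (hmem x).1 (List.mem_toFinset.1 (hX hx))
        exact List.mem_toFinset.2 (this.resolve_left fun h => hvX (h ▸ hx))
      simpa [List.filter_append, List.filter_cons, hvX] using hcost X hXL

theorem IsShortcutOrder.exists_length_succ (hc : IsMetric c) (hT : T.IsTree) {L : List V}
    (hL : IsShortcutOrder c T r L) {u : V} (hu : u ∉ L) :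
    ∃ L', IsShortcutOrder c T r L' ∧ L'.length = L.length + 1 := by
  obtain ⟨q⟩ := hT.connected.preconnected r u
  obtain ⟨d, -, hd₁, hd₂⟩ := q.exists_boundary_dart {x | x ∈ L} hL.2.1 hu
  obtain ⟨A, B, rfl⟩ := List.append_of_mem (show d.fst ∈ L from hd₁)
  refine ⟨_, hL.insert_leaf hc hT d.adj hd₂, ?_⟩
  simp only [List.length_append, List.length_cons]
  omega

theorem exists_isShortcutOrder_forall_mem [Fintype V] (hc : IsMetric c) (hT : T.IsTree) (r : V) :
    ∃ L, IsShortcutOrder c T r L ∧ ∀ v, v ∈ L := by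
  have extend : ∀ (m : ℕ) (L : List V), IsShortcutOrder c T r L →
      Fintype.card V ≤ L.length + m → ∃ L, IsShortcutOrder c T r L ∧ ∀ v, v ∈ L := by
    intro m
    induction m with
    | zero =>
      intro L hL hlen
      refine ⟨L, hL, fun v => ?_⟩
      have h : L.toFinset = Finset.univ := Finset.eq_univ_of_card _ <|
        le_antisymm (Finset.card_le_univ _) (by rwa [List.toFinset_card_of_nodup hL.1])
      exact List.mem_toFinset.1 (h ▸ Finset.mem_univ v)
    | succ m ih =>
      intro L hL hlen
      by_cases hall : ∀ v, v ∈ L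
      · exact ⟨L, hL, hall⟩
      · obtain ⟨u, hu⟩ := not_forall.1 hall
        obtain ⟨L', hL', hlen'⟩ := hL.exists_length_succ hc hT hu
        exact ih L' hL' (by omega)
  exact extend (Fintype.card V) [r] (.singleton_root hc hT) (by omega)

end DepthFirstOrder

theorem exists_perm_map_finRange_eq {n : ℕ} (L : List (Fin n)) (hL : L.Nodup)
    (hmem : ∀ v, v ∈ L) : ∃ σ : Equiv.Perm (Fin n), (List.finRange n).map σ = L := by
  have hlen : n = L.length := by
    simpa using (Fintype.card_congr (hL.getEquivOfForallMemList L hmem)).symm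
  refine ⟨(finCongr hlen).trans (hL.getEquivOfForallMemList L hmem), ?_⟩
  refine List.ext_getElem (by simpa using hlen) fun i h₁ h₂ => ?_
  simp

theorem IsMetric.exists_perm_tourCost_le {n : ℕ} {c : Fin n → Fin n → ℝ} (hc : IsMetric c)
    {T : SimpleGraph (Fin n)} (hT : T.IsTree) (r : Fin n) :
    ∃ σ : Equiv.Perm (Fin n), ∀ X : Finset (Fin n),
      tourCost c r (permInduced σ X) ≤ 2 * subtreeCost c T r X := by
  obtain ⟨L, hL, hmem⟩ := exists_isShortcutOrder_forall_mem hc hT r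
  obtain ⟨σ, hσ⟩ := exists_perm_map_finRange_eq L hL.1 hmem
  refine ⟨σ, fun X => ?_⟩
  rw [permInduced, hσ]
  exact hL.2.2.2 X fun v _ => List.mem_toFinset.2 (hmem v)

namespace FinDist

variable {A B : Type*}

/-- The distribution of `f a` when `a` is drawn from `D`. -/
noncomputable def map (f : A → B) (D : FinDist A) : FinDist B where
  w := D.w.mapDomain f
  nonneg := Finsupp.mapDomain_nonneg D.nonneg
  total := by
    have h := Finsupp.sum_mapDomain_index (f := f) (s := D.w) (h := fun _ x => x)
      (fun _ => rfl) (fun _ _ _ => rfl)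
    exact h.trans D.total

theorem exp_map (f : A → B) (D : FinDist A) (g : B → ℝ) :
    (D.map f).exp g = D.exp (fun a => g (f a)) :=
  Finsupp.sum_mapDomain_index (h := fun b x => x * g b) (fun _ => zero_mul _)
    (fun _ _ _ => add_mul _ _ _)

theorem exp_le_exp (D : FinDist A) {f g : A → ℝ} (h : ∀ a ∈ D.support, f a ≤ g a) :
    D.exp f ≤ D.exp g :=
  Finset.sum_le_sum fun a ha => mul_le_mul_of_nonneg_left (h a ha) (D.nonneg a)

theorem exp_const_mul (D : FinDist A) (k : ℝ) (f : A → ℝ) :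
    D.exp (fun a => k * f a) = k * D.exp f := by
  simp only [exp, Finset.mul_sum]
  exact Finset.sum_congr rfl fun a _ => mul_left_comm _ _ _

end FinDist

/-- An `α`-approximate universal Steiner tree algorithm returning spanning trees implies
a `2α`-approximate universal TSP algorithm: if some distribution `D` over spanning trees
satisfies `E_{T←D}[c(T[X])] ≤ α·opt_ST(X)` for every `X`, then some distribution `D'`
over permutations satisfies `E_{σ←D'}[c(σ_X)] ≤ 2α·opt_TSP(X)` for every `X`. -/
theorem universal_steiner_gives_universal_tsp {n : ℕ}
    (c : Fin n → Fin n → ℝ) (hc : IsMetric c) (r : Fin n) (α : ℝ) (hα : 1 ≤ α)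
    (D : FinDist (SimpleGraph (Fin n)))
    (htree : ∀ T ∈ D.support, T.IsTree)
    (hst : ∀ X : Finset (Fin n), D.exp (fun T => subtreeCost c T r X) ≤ α * optST c r X) :
    ∃ D' : FinDist (Equiv.Perm (Fin n)),
      ∀ X : Finset (Fin n),
        D'.exp (fun σ => tourCost c r (permInduced σ X)) ≤ 2 * α * optTSP c r X := by
  have hex : ∀ T : SimpleGraph (Fin n), ∃ σ : Equiv.Perm (Fin n), T ∈ D.support →
      ∀ X : Finset (Fin n), tourCost c r (permInduced σ X) ≤ 2 * subtreeCost c T r X := by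
    intro T
    by_cases h : T ∈ D.support
    · obtain ⟨σ, hσ⟩ := hc.exists_perm_tourCost_le (htree T h) r
      exact ⟨σ, fun _ => hσ⟩
    · exact ⟨1, fun h' => absurd h' h⟩
  choose f hf using hex
  refine ⟨D.map f, fun X => ?_⟩
  calc (D.map f).exp (fun σ => tourCost c r (permInduced σ X))
      = D.exp (fun T => tourCost c r (permInduced (f T) X)) := D.exp_map f _
    _ ≤ D.exp (fun T => 2 * subtreeCost c T r X) := D.exp_le_exp fun T hT => hf T hT X
    _ = 2 * D.exp (fun T => subtreeCost c T r X) := D.exp_const_mul 2 _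
    _ ≤ 2 * (α * optST c r X) := by linarith [hst X]
    _ ≤ 2 * (α * optTSP c r X) := by
      have := mul_le_mul_of_nonneg_left (hc.optST_le_optTSP r X) (zero_le_one.trans hα)
      linarith
    _ = 2 * α * optTSP c r X := by ring
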